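/- Let d ≥ 1, L ≥ 0, let μ be a probability measure on ℝ^d, and let v_θ, v_base : ℝ^d × [0,1] → ℝ^d be continuous with v_base L-Lipschitz in its first argument uniformly in t. Let φ, ψ : ℝ^d × [0,1] → ℝ^d be such that for μ-almost every x₀: t ↦ φ(x₀,t) is differentiable with ∂_t φ(x₀,t) = v_θ(φ(x₀,t),t) and φ(x₀,0) = x₀, and t ↦ ψ(x₀,t) is differentiable with ∂_t ψ(x₀,t) = v_base(ψ(x₀,t),t) and ψ(x₀,0) = x₀. Assume x₀ ↦ ‖φ(x₀,1) − ψ(x₀,1)‖² and x₀ ↦ ∫₀¹ ‖v_θ(φ(x₀,s),s) − v_base(φ(x₀,s),s)‖² ds are μ-measurable with the latter μ-integrable. Then ∫ ‖φ(x₀,1) − ψ(x₀,1)‖² dμ(x₀) ≤ e^{2L+1} ∫ ( ∫₀¹ ‖v_θ(φ(x₀,s),s) − v_base(φ(x₀,s),s)‖² ds ) dμ(x₀). -/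

import Mathlib

open MeasureTheory

/-- Grönwall's inequality with a nonnegative, time-dependent forcing term. -/
theorem le_exp_mul_add_integral_of_deriv_le {u u' g : ℝ → ℝ} {K a b : ℝ} (hK : 0 ≤ K)
    (hab : a ≤ b) (hu : ∀ t ∈ Set.Icc a b, HasDerivAt u (u' t) t)
    (hg : ContinuousOn g (Set.Icc a b)) (hg0 : ∀ t ∈ Set.Icc a b, 0 ≤ g t)
    (hle : ∀ t ∈ Set.Icc a b, u' t ≤ K * u t + g t) :
    u b ≤ Real.exp (K * (b - a)) * (u a + ∫ s in a..b, g s) := by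
  have hint : IntervalIntegrable g volume a b := hg.intervalIntegrable_of_Icc hab
  have hcont : ContinuousOn
      (fun t => Real.exp (-(K * (t - a))) * u t - ∫ s in a..t, g s) (Set.Icc a b) := by
    refine ContinuousOn.sub (ContinuousOn.mul (by fun_prop)
      fun t ht => (hu t ht).continuousAt.continuousWithinAt) ?_
    simpa only [Set.uIcc_of_le hab] using
      intervalIntegral.continuousOn_primitive_interval' hint Set.left_mem_uIcc
  have hderiv : ∀ t ∈ Set.Ioo a b, HasDerivAt
      (fun t => Real.exp (-(K * (t - a))) * u t - ∫ s in a..t, g s)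
      (Real.exp (-(K * (t - a))) * (-K) * u t + Real.exp (-(K * (t - a))) * u' t - g t) t := by
    intro t ht
    have hexp : HasDerivAt (fun t => Real.exp (-(K * (t - a))))
        (Real.exp (-(K * (t - a))) * (-K)) t := by
      simpa using ((((hasDerivAt_id t).sub_const a).const_mul K).neg).exp
    have hprim : HasDerivAt (fun t => ∫ s in a..t, g s) (g t) t := by
      refine intervalIntegral.integral_hasDerivAt_right
        (hint.mono_set ?_) ?_ (hg.continuousAt (Icc_mem_nhds ht.1 ht.2))
      · rw [Set.uIcc_of_le ht.1.le, Set.uIcc_of_le hab]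
        exact Set.Icc_subset_Icc_right ht.2.le
      · exact (hg.mono Set.Ioo_subset_Icc_self).stronglyMeasurableAtFilter isOpen_Ioo t ht
    exact (hexp.mul (hu t (Set.Ioo_subset_Icc_self ht))).sub hprim
  have hanti := antitoneOn_of_deriv_nonpos (convex_Icc a b) hcont
    (fun t ht => by
      rw [interior_Icc] at ht
      exact (hderiv t ht).differentiableAt.differentiableWithinAt)
    (fun t ht => by
      rw [interior_Icc] at ht
      rw [(hderiv t ht).deriv]
      have ht' := Set.Ioo_subset_Icc_self ht
      have hexp1 : Real.exp (-(K * (t - a))) ≤ 1 :=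
        Real.exp_le_one_iff.2 (neg_nonpos.2 (mul_nonneg hK (sub_nonneg.2 ht'.1)))
      have hscaled := mul_le_mul_of_nonneg_left (hle t ht')
        (Real.exp_pos (-(K * (t - a)))).le
      have hdecay := mul_le_mul_of_nonneg_right hexp1 (hg0 t ht')
      linarith)
  have hend := hanti (Set.left_mem_Icc.2 hab) (Set.right_mem_Icc.2 hab) hab
  simp only [sub_self, mul_zero, neg_zero, Real.exp_zero, one_mul,
    intervalIntegral.integral_same, sub_zero] at hend
  calc u b = Real.exp (K * (b - a)) * (Real.exp (-(K * (b - a))) * u b) := by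
        rw [← mul_assoc, ← Real.exp_add, add_neg_cancel, Real.exp_zero, one_mul]
    _ ≤ _ := by gcongr; linarith

/-- Two trajectories with a common initial point, the second driven by a Lipschitz field `w`,
differ in square at time `1` by at most `exp (2 * L + 1)` times the energy of the difference of
the two fields along the first trajectory. -/
theorem norm_sub_sq_le_exp_mul_integral {E : Type*} [NormedAddCommGroup E]
    [InnerProductSpace ℝ E] {v w : E × ℝ → E} {L : ℝ} (hL : 0 ≤ L)
    (hv : ContinuousOn v (Set.univ ×ˢ Set.Icc (0 : ℝ) 1))
    (hw : ContinuousOn w (Set.univ ×ˢ Set.Icc (0 : ℝ) 1))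
    (hLip : ∀ x y : E, ∀ t ∈ Set.Icc (0 : ℝ) 1, ‖w (x, t) - w (y, t)‖ ≤ L * ‖x - y‖)
    {x y : ℝ → E} (hx : ∀ t ∈ Set.Icc (0 : ℝ) 1, HasDerivAt x (v (x t, t)) t)
    (hy : ∀ t ∈ Set.Icc (0 : ℝ) 1, HasDerivAt y (w (y t, t)) t) (h0 : x 0 = y 0) :
    ‖x 1 - y 1‖ ^ 2 ≤
      Real.exp (2 * L + 1) * ∫ s in (0 : ℝ)..1, ‖v (x s, s) - w (x s, s)‖ ^ 2 := by
  have hpath : ContinuousOn (fun t => (x t, t)) (Set.Icc (0 : ℝ) 1) :=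
    ContinuousOn.prodMk (fun t ht => (hx t ht).continuousAt.continuousWithinAt) continuousOn_id
  have hmaps : Set.MapsTo (fun t => (x t, t)) (Set.Icc (0 : ℝ) 1)
      (Set.univ ×ˢ Set.Icc (0 : ℝ) 1) := fun t ht => ⟨Set.mem_univ _, ht⟩
  have hbound := le_exp_mul_add_integral_of_deriv_le (u := fun t => ‖x t - y t‖ ^ 2)
    (g := fun t => ‖v (x t, t) - w (x t, t)‖ ^ 2) (K := 2 * L + 1) (by positivity) zero_le_one
    (fun t ht => ((hx t ht).sub (hy t ht)).norm_sq)
    (((hv.comp hpath hmaps).sub (hw.comp hpath hmaps)).norm.pow 2)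
    (fun t _ => sq_nonneg _) (fun t ht => by
      have hsplit : v (x t, t) - w (y t, t) =
          (v (x t, t) - w (x t, t)) + (w (x t, t) - w (y t, t)) := by abel
      have hres := real_inner_le_norm (x t - y t) (v (x t, t) - w (x t, t))
      have hlip := (real_inner_le_norm (x t - y t) (w (x t, t) - w (y t, t))).trans
        (mul_le_mul_of_nonneg_left (hLip (x t) (y t) t ht) (norm_nonneg _))
      simp only [Pi.sub_apply]
      rw [hsplit, inner_add_right]
      nlinarith [sq_nonneg (‖x t - y t‖ - ‖v (x t, t) - w (x t, t)‖)])
  simpa [h0] using hbound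

/-- expectation form of the `W₂` bound. Let `μ` be a probability measure on
`ℝ^d`, `v_θ, v_base` continuous with `v_base` `L`-Lipschitz in the first argument uniformly
in `t ∈ [0,1]`, and let `φ, ψ` be the flow maps of `ẋ = v_θ(x,t)` and `ẋ = v_base(x,t)` from
a common `μ`-a.e. initial point.  Then
`∫ ‖φ(x₀,1) − ψ(x₀,1)‖² dμ ≤ e^{2L+1} ∫ (∫₀¹ ‖v_θ(φ(x₀,s),s) − v_base(φ(x₀,s),s)‖² ds) dμ`. -/
theorem stmt_6 (d : ℕ) (hd : 1 ≤ d) (L : ℝ) (hL : 0 ≤ L)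
    (μ : Measure (EuclideanSpace ℝ (Fin d))) [IsProbabilityMeasure μ]
    (vθ vbase : EuclideanSpace ℝ (Fin d) × ℝ → EuclideanSpace ℝ (Fin d))
    (hvθ : ContinuousOn vθ (Set.univ ×ˢ Set.Icc (0 : ℝ) 1))
    (hvbase : ContinuousOn vbase (Set.univ ×ˢ Set.Icc (0 : ℝ) 1))
    (hLip : ∀ x y : EuclideanSpace ℝ (Fin d), ∀ t ∈ Set.Icc (0 : ℝ) 1,
      ‖vbase (x, t) - vbase (y, t)‖ ≤ L * ‖x - y‖)
    (φ ψ : EuclideanSpace ℝ (Fin d) × ℝ → EuclideanSpace ℝ (Fin d))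
    (hφ : ∀ᵐ x₀ ∂μ,
      (∀ t ∈ Set.Icc (0 : ℝ) 1,
        HasDerivAt (fun s => φ (x₀, s)) (vθ (φ (x₀, t), t)) t) ∧ φ (x₀, 0) = x₀)
    (hψ : ∀ᵐ x₀ ∂μ,
      (∀ t ∈ Set.Icc (0 : ℝ) 1,
        HasDerivAt (fun s => ψ (x₀, s)) (vbase (ψ (x₀, t), t)) t) ∧ ψ (x₀, 0) = x₀)
    (hmeas : AEStronglyMeasurable (fun x₀ => ‖φ (x₀, 1) - ψ (x₀, 1)‖ ^ 2) μ)
    (hint : Integrable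
      (fun x₀ => ∫ s in (0 : ℝ)..1, ‖vθ (φ (x₀, s), s) - vbase (φ (x₀, s), s)‖ ^ 2) μ) :
    ∫ x₀, ‖φ (x₀, 1) - ψ (x₀, 1)‖ ^ 2 ∂μ ≤
      Real.exp (2 * L + 1) *
        ∫ x₀, (∫ s in (0 : ℝ)..1, ‖vθ (φ (x₀, s), s) - vbase (φ (x₀, s), s)‖ ^ 2) ∂μ := by
  rw [← integral_const_mul]
  refine integral_mono_of_nonneg (.of_forall fun _ => sq_nonneg _) (hint.const_mul _) ?_
  filter_upwards [hφ, hψ] with x₀ hx hy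
  exact norm_sub_sq_le_exp_mul_integral (x := fun s => φ (x₀, s)) (y := fun s => ψ (x₀, s))
    hL hvθ hvbase hLip hx.1 hy.1 (hx.2.trans hy.2.symm)
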